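/- Let h = 2n+1 be an odd integer with n ≥ 1, let 0 ≤ i ≤ n, let σ be an h-bar-core with exactly k ≥ 1 addable i-nodes and let τ = ψ_i(σ), so that P_{σ,w} and P_{τ,w} form a [w:k]-pair of residue i. Suppose λ, μ ∈ P_{σ,w} and λ̂, μ̂ ∈ P_{τ,w} satisfy λ ↔ᵢ λ̂ and μ ↔ᵢ μ̂, and that λ has no removable i-node. Then: (1) if μ <lex λ then μ̂ <lex λ̂; (2) if λ <colex μ then λ̂ <colex μ̂. -/

import Mathlib

/-- A partition: a weakly decreasing sequence of non-negative integers with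
finite sum (finitely many nonzero parts), indexed from 0 (so `parts 0` is λ₁). -/
structure BPartition where
  parts : ℕ →₀ ℕ
  antitone : ∀ r, parts (r + 1) ≤ parts r

namespace BPartition

/-- The multiset of positive parts of a partition. -/
def partsM (lam : BPartition) : Multiset ℕ :=
  lam.parts.support.val.map (fun r => lam.parts r)

/-- The Young diagram: nodes `(r, c)` with rows indexed from 0 and columns from 1. -/
def diagram (lam : BPartition) : Set (ℕ × ℕ) :=
  {x | 1 ≤ x.2 ∧ x.2 ≤ lam.parts x.1}

/-- A partition is strict if λ_r > λ_{r+1} whenever λ_r > 0. -/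
def IsStrict (lam : BPartition) : Prop :=
  ∀ r, 0 < lam.parts r → lam.parts (r + 1) < lam.parts r

/-- A partition is h-strict if each part is either strictly bigger than the next,
or positive and divisible by h, or zero. -/
def IsHStrict (h : ℕ) (lam : BPartition) : Prop :=
  ∀ r, lam.parts (r + 1) < lam.parts r ∨ (0 < lam.parts r ∧ h ∣ lam.parts r) ∨ lam.parts r = 0

/-- An h-strict partition is restricted if for every r either λ_{r+1} > λ_r − h,
or λ_{r+1} = λ_r − h and h does not divide λ_r. -/
def IsRestricted (h : ℕ) (lam : BPartition) : Prop :=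
  ∀ r, lam.parts r < lam.parts (r + 1) + h ∨
    (lam.parts (r + 1) + h = lam.parts r ∧ ¬ h ∣ lam.parts r)

/-- The residue of a node in column c (1-indexed): the smaller of the residues of
c − 1 and of −c modulo h. -/
def colRes (h c : ℕ) : ℕ := min ((c - 1) % h) ((h - c % h) % h)

/-- `x` is an addable i-node of `lam`. -/
def Addable (h i : ℕ) (lam : BPartition) (x : ℕ × ℕ) : Prop :=
  colRes h x.2 = i ∧ x ∉ diagram lam ∧
  ∃ nu : BPartition, IsHStrict h nu ∧ diagram lam ⊆ diagram nu ∧ x ∈ diagram nu ∧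
    ∀ y ∈ diagram nu, y ∉ diagram lam → colRes h y.2 = i

/-- `x` is a removable i-node of `lam`. -/
def Removable (h i : ℕ) (lam : BPartition) (x : ℕ × ℕ) : Prop :=
  x ∈ diagram lam ∧
  ∃ mu : BPartition, IsHStrict h mu ∧ diagram mu ⊆ diagram lam ∧ x ∉ diagram mu ∧
    ∀ y ∈ diagram lam, y ∉ diagram mu → colRes h y.2 = i

/-- Removal of a single h-bar from `lam` giving `mu`, recording the value `v`:
either a part `v ≥ h` is replaced by `v − h` (deleted if `v = h`), or two parts
summing to `h` are deleted, in which case `v` is the larger of the two. -/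
def barStepRec (h : ℕ) (lam mu : BPartition) (v : ℕ) : Prop :=
  IsHStrict h mu ∧
  ((v = h ∧ v ∈ partsM lam ∧ partsM mu = (partsM lam).erase v) ∨
   (h < v ∧ v ∈ partsM lam ∧ partsM mu = (v - h) ::ₘ (partsM lam).erase v) ∨
   (∃ a b : ℕ, a + b = h ∧ a ∈ partsM lam ∧ b ∈ (partsM lam).erase a ∧
      v = max a b ∧ partsM mu = ((partsM lam).erase a).erase b))

/-- Removal of a single h-bar. -/
def barStep (h : ℕ) (lam mu : BPartition) : Prop :=
  ∃ v, barStepRec h lam mu v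

/-- An h-bar-core: an h-strict partition from which no h-bar can be removed. -/
def IsBarCore (h : ℕ) (lam : BPartition) : Prop :=
  IsHStrict h lam ∧ ∀ mu, ¬ barStep h lam mu

/-- A chain of `w` h-bar removals from `lam` down to `mu`. -/
def barChain (h : ℕ) : ℕ → BPartition → BPartition → Prop
  | 0, lam, mu => lam = mu
  | w + 1, lam, mu => ∃ nu, barStep h lam nu ∧ barChain h w nu mu

/-- `lam ∈ P_{τ,w}`: `lam` is h-strict with h-bar-core `tau` and h-bar-weight `w`. -/
def InBlock (h : ℕ) (tau : BPartition) (w : ℕ) (lam : BPartition) : Prop :=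
  IsHStrict h lam ∧ IsBarCore h tau ∧ barChain h w lam tau

/-- The left-to-right order on node positions along the edge of a Young diagram:
smaller column first; within a column, larger row first. -/
def posLE (x y : ℕ × ℕ) : Prop := x.2 < y.2 ∨ (x.2 = y.2 ∧ y.1 ≤ x.1)

/-- `x` is a normal i-node: a removable i-node surviving (as a − sign) in the
reduced i-signature; equivalently, every window of the i-signature ending at `x`
contains strictly more removable than addable i-nodes. -/
def Normal (h i : ℕ) (lam : BPartition) (x : ℕ × ℕ) : Prop :=
  Removable h i lam x ∧ ∀ z : ℕ × ℕ, posLE z x →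
    Set.ncard {y | Addable h i lam y ∧ posLE z y ∧ posLE y x} <
      Set.ncard {y | Removable h i lam y ∧ posLE z y ∧ posLE y x}

/-- `x` is a conormal i-node: an addable i-node surviving (as a + sign) in the
reduced i-signature. -/
def Conormal (h i : ℕ) (lam : BPartition) (x : ℕ × ℕ) : Prop :=
  Addable h i lam x ∧ ∀ z : ℕ × ℕ, posLE x z →
    Set.ncard {y | Removable h i lam y ∧ posLE x y ∧ posLE y z} <
      Set.ncard {y | Addable h i lam y ∧ posLE x y ∧ posLE y z}

/-- The node set of ψ_i(λ): add the leftmost s − r conormal i-nodes if s ≥ r,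
remove the rightmost r − s normal i-nodes if r > s, where r = #normal and
s = #conormal i-nodes. -/
noncomputable def psiSet (h i : ℕ) (lam : BPartition) : Set (ℕ × ℕ) :=
  if Set.ncard {x | Normal h i lam x} ≤ Set.ncard {x | Conormal h i lam x} then
    diagram lam ∪ {x | Conormal h i lam x ∧
      Set.ncard {y | Conormal h i lam y ∧ posLE y x} ≤
        Set.ncard {x | Conormal h i lam x} - Set.ncard {x | Normal h i lam x}}
  else
    diagram lam \ {x | Normal h i lam x ∧
      Set.ncard {y | Normal h i lam y ∧ posLE x y} ≤
        Set.ncard {x | Normal h i lam x} - Set.ncard {x | Conormal h i lam x}}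

open Classical in
/-- The involution ψ_i. -/
noncomputable def psi (h i : ℕ) (lam : BPartition) : BPartition :=
  if hex : ∃ mu : BPartition, diagram mu = psiSet h i lam then hex.choose else lam

/-- The set of occupied positions of the abacus display of a strict partition. -/
def abacus (lam : BPartition) : Set ℤ :=
  {a | a = 0 ∨ (0 < a ∧ a.toNat ∈ partsM lam) ∨ (a < 0 ∧ (-a).toNat ∉ partsM lam)}

/-- The dominance order: λ ⊴ μ. -/
def domLE (lam mu : BPartition) : Prop :=
  ∀ r, ∑ s ∈ Finset.range r, lam.parts s ≤ ∑ s ∈ Finset.range r, mu.parts s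

/-- Strict dominance: λ ◁ μ. -/
def domLT (lam mu : BPartition) : Prop := domLE lam mu ∧ lam ≠ mu

/-- Lexicographic order: λ <lex μ. -/
def lexLT (lam mu : BPartition) : Prop :=
  ∃ r, lam.parts r < mu.parts r ∧ ∀ s < r, lam.parts s = mu.parts s

/-- Colexicographic order: λ <colex μ. -/
def colexLT (lam mu : BPartition) : Prop :=
  ∃ r, mu.parts r < lam.parts r ∧ ∀ s, r < s → lam.parts s = mu.parts s

/-- λ ↔ᵢ μ: every node of the symmetric difference of the diagrams has residue i. -/
def Link (h i : ℕ) (lam mu : BPartition) : Prop :=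
  ∀ x : ℕ × ℕ, x ∈ (diagram lam \ diagram mu) ∪ (diagram mu \ diagram lam) →
    colRes h x.2 = i

/-- `a ≤ b` are the bar positions of `lam ∈ P_{τ,2}`: the values recorded by
some two-step removal of h-bars from `lam` down to `tau`. -/
def BarPositions (h : ℕ) (tau lam : BPartition) (a b : ℕ) : Prop :=
  a ≤ b ∧ ∃ (nu : BPartition) (v₁ v₂ : ℕ), barStepRec h lam nu v₁ ∧ barStepRec h nu tau v₂ ∧
    ({a, b} : Multiset ℕ) = {v₁, v₂}

/-- The leg length of the bar of `lam ∈ P_{τ,2}` at bar position `c`. -/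
noncomputable def legLen (h : ℕ) (tau lam : BPartition) (c : ℕ) : ℕ :=
  if h ≤ c then Set.ncard {x : ℕ | c - h < x ∧ x < c ∧ x ∈ partsM lam ∧ x ∈ partsM tau}
  else (h - c) + Set.ncard {x : ℕ | h - c < x ∧ x < c ∧ x ∈ partsM lam ∧ x ∈ partsM tau}

/-- ∂λ: the absolute difference of the two leg lengths of `lam`, whose bar
positions are `a ≤ b`. -/
noncomputable def ddd (h : ℕ) (tau lam : BPartition) (a b : ℕ) : ℕ :=
  max (legLen h tau lam a) (legLen h tau lam b) - min (legLen h tau lam a) (legLen h tau lam b)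

inductive Colour | black | white | grey
deriving DecidableEq

/-- β(τ): the number of parts of τ less than h. -/
def betaCount (h : ℕ) (tau : BPartition) : ℕ :=
  Multiset.card ((partsM tau).filter (fun x => x < h))

/-- The leg length of a 2h-bar of `lam` with larger bar position `b`. -/
noncomputable def legLen2 (h : ℕ) (tau lam : BPartition) (b : ℕ) : ℕ :=
  if 2 * h ≤ b then Set.ncard {x : ℕ | b - 2 * h < x ∧ x < b ∧ x ∈ partsM lam ∧ x ∈ partsM tau}
  else (2 * h - b) + Set.ncard {x : ℕ | 2 * h - b < x ∧ x < b ∧ x ∈ partsM lam ∧ x ∈ partsM tau}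

/-- The colour of `lam ∈ P_{τ,2}` with bar positions `a ≤ b`. -/
noncomputable def colour (h : ℕ) (tau lam : BPartition) (a b : ℕ) : Colour :=
  if 2 ≤ ddd h tau lam a b then Colour.grey
  else if ddd h tau lam a b = 1 then
    if h < b then Colour.grey
    else if (min (legLen h tau lam a) (legLen h tau lam b) + betaCount h tau) % 2 = 1 then
      Colour.black else Colour.white
  else
    if b = a + h ∨ a + b = 2 * h then
      if (legLen2 h tau lam b + 2 * betaCount h tau) % 4 = 0 ∨
         (legLen2 h tau lam b + 2 * betaCount h tau) % 4 = 3 then Colour.black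
      else Colour.white
    else
      if (legLen h tau lam a + betaCount h tau) % 2 = 1 then Colour.black else Colour.white

end BPartition

namespace BPartition

theorem s_anti (l : BPartition) {r s : ℕ} (h : r ≤ s) : l.parts s ≤ l.parts r :=
  antitone_nat_of_succ_le l.antitone h

theorem s_ext {l m : BPartition} (h : ∀ r, l.parts r = m.parts r) : l = m := by
  cases l; cases m
  congr
  ext r
  exact h r

theorem s_bound (l : BPartition) : ∃ R, ∀ r, R ≤ r → l.parts r = 0 := by
  refine ⟨l.parts.support.sup id + 1, fun r hr => ?_⟩
  by_contra hne
  have := Finset.le_sup (f := id) (Finsupp.mem_support_iff.mpr hne)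
  simp at this
  omega

theorem s_mk (f : ℕ → ℕ) (hf : ∀ r, f (r+1) ≤ f r) (hR : ∃ R, ∀ r, R ≤ r → f r = 0) :
    ∃ l : BPartition, ∀ r, l.parts r = f r := by
  obtain ⟨R, hR⟩ := hR
  refine ⟨⟨Finsupp.onFinset (Finset.range R) f ?_, ?_⟩, ?_⟩
  · intro a ha
    rw [Finset.mem_range]
    by_contra hc
    exact ha (hR a (by omega))
  · intro r; simpa using hf r
  · intro r; simp

/-- hstrict restated -/
theorem s_hs {h : ℕ} {l : BPartition} : IsHStrict h l ↔
    ∀ r, l.parts (r+1) = l.parts r → h ∣ l.parts r := by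
  constructor
  · intro H r hr
    rcases H r with h1 | h1 | h1
    · omega
    · exact h1.2
    · rw [h1]; exact dvd_zero h
  · intro H r
    have := l.antitone r
    rcases Nat.lt_or_ge (l.parts (r+1)) (l.parts r) with h1 | h1
    · exact Or.inl h1
    · right
      rcases Nat.eq_zero_or_pos (l.parts r) with h2 | h2
      · exact Or.inr h2
      · exact Or.inl ⟨h2, H r (by omega)⟩

theorem s_modsucc (h p : ℕ) (hh : 0 < h) :
    (p % h + 1 = h ∧ (p+1) % h = 0) ∨ (p % h + 1 < h ∧ (p+1) % h = p % h + 1) := by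
  have h1 := Nat.mod_lt p hh
  rw [Nat.add_mod]
  rcases Nat.lt_or_ge 1 h with h2 | h2
  · rw [Nat.mod_eq_of_lt h2]
    rcases Nat.lt_or_ge (p % h + 1) h with h3 | h3
    · right; exact ⟨h3, Nat.mod_eq_of_lt h3⟩
    · left
      have : p % h + 1 = h := by omega
      rw [this]; simp
  · have : h = 1 := by omega
    subst this
    left; omega

theorem s_col (n h i c : ℕ) (hn : 1 ≤ n) (hh : h = 2*n+1) (hi : i ≤ n) :
    colRes h c = i ↔ (c % h = i+1 ∨ c % h + i = h ∨ (c % h = 0 ∧ i = 0)) := by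
  unfold colRes
  have hm := Nat.mod_lt c (show 0 < h by omega)
  have key : (h - c % h) % h = if c % h = 0 then 0 else h - c % h := by
    split_ifs with h0
    · simp [h0]
    · exact Nat.mod_eq_of_lt (by omega)
  rw [key]
  rcases c with _ | d
  · simp; omega
  · simp only [Nat.add_sub_cancel]
    have := s_modsucc h d (by omega)
    split_ifs with h0 <;> omega

theorem s_cons (n h i c : ℕ) (hn : 1 ≤ n) (hh : h = 2*n+1) (hi : i ≤ n)
    (h1 : colRes h c = i) (h2 : colRes h (c+1) = i) : i = 0 ∧ c % h = 0 := by
  rw [s_col n h i _ hn hh hi] at h1 h2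
  have := s_modsucc h c (by omega)
  omega

/-- extension by i-nodes -/
def SExt (h i : ℕ) (l v : BPartition) : Prop :=
  IsHStrict h v ∧ (∀ r, l.parts r ≤ v.parts r) ∧
    ∀ r c, l.parts r < c → c ≤ v.parts r → colRes h c = i

theorem s_diag_sub {l m : BPartition} : diagram l ⊆ diagram m ↔ ∀ r, l.parts r ≤ m.parts r := by
  constructor
  · intro H r
    rcases Nat.eq_zero_or_pos (l.parts r) with h0 | h0
    · omega
    · exact (H (show (r, l.parts r) ∈ diagram l from ⟨h0, le_rfl⟩)).2
  · intro H x hx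
    exact ⟨hx.1, hx.2.trans (H _)⟩

theorem s_diag_inj {l m : BPartition} (H : diagram l = diagram m) : l = m :=
  s_ext fun r => le_antisymm (s_diag_sub.1 H.le r) (s_diag_sub.1 H.ge r)

theorem s_addable {h i : ℕ} {l : BPartition} {x : ℕ × ℕ} :
    Addable h i l x ↔ x ∉ diagram l ∧ ∃ v, SExt h i l v ∧ x ∈ diagram v := by
  constructor
  · rintro ⟨h1, h2, v, h3, h4, h5, h6⟩
    refine ⟨h2, v, ⟨h3, s_diag_sub.1 h4, ?_⟩, h5⟩
    intro r c hc1 hc2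
    refine h6 (r, c) ⟨?_, hc2⟩ ?_
    · show 1 ≤ c
      omega
    · intro hx
      have : c ≤ l.parts r := hx.2
      omega
  · rintro ⟨h2, v, ⟨h3, h4, h6⟩, h5⟩
    have key : ∀ y ∈ diagram v, y ∉ diagram l → colRes h y.2 = i := by
      intro y hy hy2
      refine h6 y.1 y.2 ?_ hy.2
      by_contra hc
      exact hy2 ⟨hy.1, by omega⟩
    exact ⟨key x h5 h2, h2, v, h3, s_diag_sub.2 h4, h5, key⟩

theorem s_removable {h i : ℕ} {l : BPartition} {x : ℕ × ℕ} :
    Removable h i l x ↔ x ∈ diagram l ∧ ∃ m, IsHStrict h m ∧ (∀ r, m.parts r ≤ l.parts r) ∧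
      (∀ r c, m.parts r < c → c ≤ l.parts r → colRes h c = i) ∧ x ∉ diagram m := by
  constructor
  · rintro ⟨h1, m, h3, h4, h5, h6⟩
    refine ⟨h1, m, h3, s_diag_sub.1 h4, ?_, h5⟩
    intro r c hc1 hc2
    refine h6 (r, c) ⟨?_, hc2⟩ ?_
    · show 1 ≤ c
      omega
    · intro hx
      have : c ≤ m.parts r := hx.2
      omega
  · rintro ⟨h1, m, h3, h4, h6, h5⟩
    refine ⟨h1, m, h3, s_diag_sub.2 h4, h5, ?_⟩
    intro y hy hy2
    refine h6 y.1 y.2 ?_ hy.2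
    by_contra hc
    exact hy2 ⟨hy.1, by omega⟩

/-- consequence of no removable nodes, row-wise -/
theorem s_norem (n h i : ℕ) (hn : 1 ≤ n) (hh : h = 2*n+1) (l : BPartition)
    (hl : IsHStrict h l) (hr : ∀ x, ¬ Removable h i l x) (r : ℕ) (hC : colRes h (l.parts r) = i) :
    (l.parts (r+1) = l.parts r ∧ h ∣ l.parts r) ∨
    (l.parts (r+1) + 1 = l.parts r ∧ ¬ h ∣ l.parts (r+1)) := by
  have ha := l.antitone r
  rw [s_hs] at hl
  rcases Nat.lt_or_ge (l.parts (r+1)) (l.parts r) with h1 | h1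
  swap
  · left; exact ⟨by omega, hl r (by omega)⟩
  by_contra hcon
  push Not at hcon
  obtain ⟨-, hcon⟩ := hcon
  obtain ⟨m, hm⟩ := s_mk (fun s => if s = r then l.parts r - 1 else l.parts s) (by
    intro s
    have := l.antitone s
    by_cases e1 : s = r
    · subst e1; simp; omega
    · by_cases e2 : s + 1 = r
      · subst e2; simp; omega
      · simp [e1, e2]; exact this) (by
    obtain ⟨R, hR⟩ := s_bound l
    refine ⟨R, fun s hs => ?_⟩
    have := hR s hs
    by_cases e1 : s = r
    · subst e1; simp; omega
    · simp [e1]; exact this)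
  refine hr (r, l.parts r) (s_removable.2 ⟨⟨by show 1 ≤ l.parts r; omega, le_rfl⟩, m, ?_, ?_, ?_, ?_⟩)
  · rw [s_hs]
    intro s
    have := l.antitone s
    rw [hm, hm]
    by_cases e1 : s = r
    · subst e1
      simp
      intro e
      rw [← e]
      exact hcon (by omega)
    · by_cases e2 : s + 1 = r
      · subst e2; simp; omega
      · simp [e1, e2]; exact hl s
  · intro s
    rw [hm]
    by_cases e1 : s = r
    · subst e1; simp
    · simp [e1]
  · intro s c
    rw [hm]
    by_cases e1 : s = r
    · subst e1
      simp
      intro e e'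
      have : c = l.parts s := by omega
      rw [this]; exact hC
    · simp [e1]; omega
  · intro hx
    have := hx.2
    simp [hm] at this
    omega

theorem s_link_le (h i : ℕ) (l m : BPartition) (hl : IsHStrict h l) (hm : IsHStrict h m)
    (hr : ∀ x, ¬ Removable h i l x) (hL : Link h i l m) (r : ℕ) : l.parts r ≤ m.parts r := by
  by_contra hc
  rw [s_hs] at hl hm
  obtain ⟨v, hv⟩ := s_mk (fun s => min (l.parts s) (m.parts s)) (by
    intro s
    have := l.antitone s
    have := m.antitone s
    simp; omega) (by
    obtain ⟨R, hR⟩ := s_bound l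
    exact ⟨R, fun s hs => by simp [hR s hs]⟩)
  refine hr (r, l.parts r) (s_removable.2 ⟨⟨by show 1 ≤ l.parts r; omega, le_rfl⟩, v, ?_, ?_, ?_, ?_⟩)
  · rw [s_hs]
    intro s
    rw [hv, hv]
    have h1 := l.antitone s
    have h2 := m.antitone s
    have h3 := hl s
    have h4 := hm s
    intro e
    rcases Nat.le_total (l.parts s) (m.parts s) with h5 | h5
    · rw [min_eq_left h5] at e ⊢
      exact h3 (by omega)
    · rw [min_eq_right h5] at e ⊢
      exact h4 (by omega)
  · intro s; rw [hv]; exact min_le_left _ _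
  · intro s c h1 h2
    rw [hv] at h1
    refine hL (s, c) (Or.inl ⟨⟨by show 1 ≤ c; omega, h2⟩, fun hx => ?_⟩)
    have : c ≤ m.parts s := hx.2
    omega
  · intro hx
    have : l.parts r ≤ v.parts r := hx.2
    rw [hv] at this
    omega

theorem s_link_col {h i : ℕ} {l m : BPartition} (hL : Link h i l m) (r c : ℕ)
    (h1 : l.parts r < c) (h2 : c ≤ m.parts r) : colRes h c = i := by
  refine hL (r, c) (Or.inr ⟨⟨by show 1 ≤ c; omega, h2⟩, fun hx => ?_⟩)
  have : c ≤ l.parts r := hx.2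
  omega

theorem s_ext_refl {h i : ℕ} {l : BPartition} (hl : IsHStrict h l) : SExt h i l l :=
  ⟨hl, fun _ => le_rfl, fun _ _ h1 h2 => by omega⟩

theorem s_ext_bound (n h i : ℕ) (hn : 1 ≤ n) (hh : h = 2*n+1) (hi : i ≤ n) {l v : BPartition}
    (H : SExt h i l v) (r : ℕ) : v.parts r ≤ l.parts r + 2 := by
  by_contra hc
  have a1 := H.2.2 r (l.parts r + 1) (by omega) (by omega)
  have a2 := H.2.2 r (l.parts r + 1 + 1) (by omega) (by omega)
  have a3 := H.2.2 r (l.parts r + 1 + 1 + 1) (by omega) (by omega)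
  have b1 := s_cons n h i _ hn hh hi a1 a2
  have b2 := s_cons n h i _ hn hh hi a2 a3
  have := s_modsucc h (l.parts r + 1) (by omega)
  omega

theorem s_plus (n h i : ℕ) (hn : 1 ≤ n) (hh : h = 2*n+1) (hi : i ≤ n) (l : BPartition)
    (hl : IsHStrict h l) : ∃ P, SExt h i l P ∧ ∀ v, SExt h i l v → ∀ r, v.parts r ≤ P.parts r := by
  classical
  let f : ℕ → ℕ := fun r => Nat.findGreatest (fun q => ∃ v, SExt h i l v ∧ v.parts r = q) (l.parts r + 2)
  have hatt : ∀ r, ∃ v, SExt h i l v ∧ v.parts r = f r := by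
    intro r
    exact Nat.findGreatest_spec (P := fun q => ∃ v, SExt h i l v ∧ v.parts r = q)
      (m := l.parts r) (by omega) ⟨l, s_ext_refl hl, rfl⟩
  have hmax : ∀ v, SExt h i l v → ∀ r, v.parts r ≤ f r := by
    intro v hv r
    exact Nat.le_findGreatest (s_ext_bound n h i hn hh hi hv r) ⟨v, hv, rfl⟩
  obtain ⟨P, hP⟩ := s_mk f (by
    intro r
    obtain ⟨v, hv, e⟩ := hatt (r+1)
    have := v.antitone r
    have := hmax v hv r
    omega) (by
    obtain ⟨R, hR⟩ := s_bound l
    refine ⟨R+1, fun s hs => ?_⟩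
    by_contra hne
    obtain ⟨v, hv, e⟩ := hatt s
    obtain ⟨t, rfl⟩ : ∃ t, s = t+1 := ⟨s-1, by omega⟩
    have e1 := hR (t+1) (by omega)
    have e0 := hR t (by omega)
    have c1 := hv.2.2 (t+1) 1 (by omega) (by omega)
    have an := v.antitone t
    have two : ¬ 2 ≤ v.parts t := by
      intro h2
      have c2 := hv.2.2 t 2 (by omega) (by omega)
      have := s_cons n h i 1 hn hh hi c1 c2
      rw [Nat.mod_eq_of_lt (by omega)] at this
      omega
    have := s_hs.1 hv.1 t (by omega)
    have h3 : v.parts t = 1 := by omega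
    rw [h3] at this
    have := Nat.le_of_dvd (by omega) this
    omega)
  refine ⟨P, ⟨?_, ?_, ?_⟩, fun v hv r => by rw [hP]; exact hmax v hv r⟩
  · rw [s_hs]
    intro r
    rw [hP, hP]
    intro e
    obtain ⟨v, hv, e'⟩ := hatt (r+1)
    have := v.antitone r
    have := hmax v hv r
    have e2 : v.parts r = f r := by omega
    rw [← e2]
    exact s_hs.1 hv.1 r (by omega)
  · intro r
    rw [hP]
    exact hmax l (s_ext_refl hl) r
  · intro r c h1 h2
    rw [hP] at h2
    obtain ⟨v, hv, e⟩ := hatt r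
    exact hv.2.2 r c h1 (by omega)

end BPartition

namespace BPartition

def sg (h i p : ℕ) : ℤ :=
  if i = 0 then (if p % h + 1 = h then 2 else if p % h = 1 then -2 else 0)
  else (if p % h = i ∨ p % h + i + 1 = h then 1
    else if p % h = i+1 ∨ p % h + i = h then -1 else 0)

def se (h i p : ℕ) : ℤ := if colRes h p = i then 1 else 0

theorem s_row0 (n h i p P : ℕ) (hn : 1 ≤ n) (hh : h = 2*n+1) (hi : i ≤ n) (hpP : p ≤ P)
    (hC : ∀ c, p < c → c ≤ P → colRes h c = i)
    (hR : colRes h p = i → p % h ≠ 1 ∨ i ≠ 0)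
    (hmax : ∀ q, p ≤ q → (∀ c, p < c → c ≤ q → colRes h c = i) → q ≤ P) :
    (P : ℤ) = p + sg h i p + se h i p := by
  have c0 := s_col n h i p hn hh hi
  have c1 := s_col n h i (p+1) hn hh hi
  have c2 := s_col n h i (p+2) hn hh hi
  have m0 := Nat.mod_lt p (show 0 < h by omega)
  have m1 := s_modsucc h p (by omega)
  have m2 := s_modsucc h (p+1) (by omega)
  have q1 : colRes h (p+1) = i → p + 1 ≤ P := fun e => hmax (p+1) (by omega) (by
    intro c a b
    have : c = p+1 := by omega
    rw [this]; exact e)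
  have q2 : colRes h (p+1) = i → colRes h (p+2) = i → p + 2 ≤ P := fun e e' =>
    hmax (p+2) (by omega) (by
    intro c a b
    have : c = p+1 ∨ c = p+2 := by omega
    rcases this with this | this <;> rw [this] <;> assumption)
  have u1 : p + 1 ≤ P → colRes h (p+1) = i := fun e => hC _ (by omega) e
  have u2 : p + 2 ≤ P → colRes h (p+2) = i := fun e => hC _ (by omega) e
  have u3 : p + 3 ≤ P → colRes h (p+3) = i := fun e => hC _ (by omega) e
  have k1 := s_cons n h i (p+1) hn hh hi
  have k2 := s_cons n h i (p+2) hn hh hi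
  clear hC hmax
  have key : (¬ colRes h (p+1) = i ∧ P = p) ∨
      (colRes h (p+1) = i ∧ ¬ colRes h (p+2) = i ∧ P = p+1) ∨
      (colRes h (p+1) = i ∧ colRes h (p+2) = i ∧ P = p+2) := by
    by_cases x1 : colRes h (p+1) = i
    · have y1 := q1 x1
      by_cases x2 : colRes h (p+2) = i
      · have y2 := q2 x1 x2
        right; right
        refine ⟨x1, x2, ?_⟩
        by_contra hne
        have z1 := (k1 x1 x2).2
        have z2 := (k2 x2 (u3 (by omega))).2
        rw [show p + 1 + 1 = p + 2 from rfl] at m2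
        omega
      · right; left
        refine ⟨x1, x2, ?_⟩
        by_contra hne
        exact x2 (u2 (by omega))
    · left
      refine ⟨x1, ?_⟩
      by_contra hne
      exact x1 (u1 (by omega))
  clear q1 q2 u1 u2 u3 k1 k2
  rw [c0] at hR
  simp only [c1, c2] at key
  unfold se
  simp only [c0]
  clear c0 c1 c2 m2
  have m2 := s_modsucc h (p+1) (by omega)
  rw [show p + 1 + 1 = p + 2 from rfl] at m2
  unfold sg
  generalize p % h = x at *
  generalize (p+1) % h = y at *
  generalize (p+2) % h = z at *
  clear hpP
  by_cases i0 : i = 0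
  · subst i0
    simp only [if_true]
    rcases key with ⟨k, rfl⟩ | ⟨k, k', rfl⟩ | ⟨k, k', rfl⟩
    · split_ifs <;> first | omega | (simp at *; omega)
    · split_ifs <;> first | omega | (simp at *; omega)
    · split_ifs <;> first | omega | (simp at *; omega)
  · simp only [if_neg i0]
    rcases key with ⟨k, rfl⟩ | ⟨k, k', rfl⟩ | ⟨k, k', rfl⟩
    · split_ifs <;> omega
    · split_ifs <;> omega
    · split_ifs <;> omega

theorem s_row1 (n h i p P a A : ℕ) (hn : 1 ≤ n) (hh : h = 2*n+1) (hi : i ≤ n) (hpP : p ≤ P)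
    (hC : ∀ c, p < c → c ≤ P → colRes h c = i)
    (hR : colRes h p = i → p % h ≠ 1 ∨ i ≠ 0)
    (hpa : p ≤ a) (hpa' : p = a → h ∣ a) (hPA : P ≤ A) (hPA' : P = A → h ∣ A)
    (hCA : ∀ c, a < c → c ≤ A → colRes h c = i)
    (hRa : colRes h a = i → (p = a ∧ h ∣ a) ∨ (p + 1 = a ∧ ¬ h ∣ p))
    (hmax : ∀ q, p ≤ q → (∀ c, p < c → c ≤ q → colRes h c = i) → (q < a ∨ (q = a ∧ h ∣ q)) → q ≤ P) :
    (P : ℤ) = p + sg h i p + se h i p - se h i a := by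
  by_cases hCa : colRes h a = i
  · simp only [Nat.dvd_iff_mod_eq_zero] at *
    have c0 := s_col n h i p hn hh hi
    have c1 := s_col n h i (p+1) hn hh hi
    have c2 := s_col n h i (p+2) hn hh hi
    have c3 := s_col n h i (p+3) hn hh hi
    have m0 := Nat.mod_lt p (show 0 < h by omega)
    have m1 := s_modsucc h p (by omega)
    have m2 := s_modsucc h (p+1) (by omega)
    have m3 := s_modsucc h (p+2) (by omega)
    rcases hRa hCa with ⟨rfl, e⟩ | ⟨rfl, e⟩
    · have v2 : p + 2 ≤ A → colRes h (p+2) = i := fun e => hCA _ (by omega) e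
      have v1 : p + 1 ≤ A → colRes h (p+1) = i := fun e => hCA _ (by omega) e
      have hA : A ≤ p + 1 := by
        by_contra hc
        have := (s_cons n h i (p+1) hn hh hi (v1 (by omega)) (v2 (by omega))).2
        omega
      have hP : P = p := by
        by_contra hne
        have h5 := hPA' (by omega)
        rw [show A = p + 1 by omega] at h5
        omega
      rw [c0] at hCa
      have hs : sg h i p = 0 := by
        unfold sg
        rw [e]
        split_ifs <;> omega
      rw [hs, hP]; ring
    · have hnC : ¬ colRes h p = i := fun x => e (s_cons n h i p hn hh hi x hCa).2
      have s1 : se h i p = 0 := if_neg hnC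
      have s2 : se h i (p+1) = 1 := if_pos hCa
      rw [s1, s2]
      by_cases i0 : i = 0
      · have z : (p+1) % h = 0 := by
          rw [c1] at hCa
          omega
        have q1 : p + 1 ≤ P := hmax (p+1) (by omega) (by
          intro c a b
          have : c = p+1 := by omega
          rw [this]; exact hCa) (Or.inr ⟨rfl, z⟩)
        have hA : A ≤ p + 2 := by
          by_contra hc
          have v1 : colRes h (p+2) = i := hCA _ (by omega) (by omega)
          have v2 : colRes h (p+3) = i := hCA _ (by omega) (by omega)
          have := (s_cons n h i (p+2) hn hh hi v1 v2).2
          rw [show p + 1 + 1 = p + 2 from rfl] at m2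
          omega
        have hP : P = p + 1 := by
          by_contra hne
          have h5 := hPA' (by omega)
          rw [show A = p + 1 + 1 by omega] at h5
          omega
        have hs : sg h i p = 2 := by
          unfold sg
          rw [if_pos i0, if_pos (by omega)]
        rw [hs, hP]; push_cast; ring
      · have z : (p+1) % h ≠ 0 := by
          rw [c1] at hCa
          omega
        have hA : A ≤ p + 1 := by
          by_contra hc
          have v1 : colRes h (p+1+1) = i := hCA _ (by omega) (by omega)
          exact i0 (s_cons n h i (p+1) hn hh hi hCa v1).1
        have hP : P = p := by
          by_contra hne
          have h5 := hPA' (by omega)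
          rw [show A = p + 1 by omega] at h5
          omega
        have hs : sg h i p = 1 := by
          unfold sg
          rw [c1] at hCa
          rw [if_neg i0, if_pos (by omega)]
        rw [hs, hP]; ring
  · have : se h i a = 0 := by unfold se; rw [if_neg hCa]
    rw [this, sub_zero]
    refine s_row0 n h i p P hn hh hi hpP hC hR ?_
    intro q hq hqC
    rcases Nat.eq_or_lt_of_le hq with e | e
    · omega
    · refine hmax q hq hqC (Or.inl ?_)
      by_contra hc
      rcases Nat.eq_or_lt_of_le hpa with e' | e'
      · have d := hpa' e'
        subst e'
        have k := hqC (p+1) (by omega) (by omega)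
        rw [s_col n h i _ hn hh hi] at k hCa
        have m1 := s_modsucc h p (by omega)
        rw [Nat.dvd_iff_mod_eq_zero] at d
        omega
      · exact hCa (hqC a e' (by omega))

/-- the maximal extension has size determined by sg -/
theorem s_count (n h i : ℕ) (hn : 1 ≤ n) (hh : h = 2*n+1) (hi : i ≤ n) (l P : BPartition)
    (hl : IsHStrict h l) (hr : ∀ x, ¬ Removable h i l x) (hP : SExt h i l P)
    (hmax : ∀ v, SExt h i l v → ∀ r, v.parts r ≤ P.parts r) (R : ℕ) :
    ∑ r ∈ Finset.range (R+1), (P.parts r : ℤ) =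
      ∑ r ∈ Finset.range (R+1), (l.parts r : ℤ) + ∑ r ∈ Finset.range (R+1), sg h i (l.parts r)
        + se h i (l.parts R) := by
  have hR : ∀ r, colRes h (l.parts r) = i → l.parts r % h ≠ 1 ∨ i ≠ 0 := by
    intro r hC
    have m1 := s_modsucc h (l.parts (r+1)) (by omega)
    rcases s_norem n h i hn hh l hl hr r hC with ⟨_, e⟩ | ⟨e, e'⟩
    · rw [Nat.dvd_iff_mod_eq_zero] at e
      omega
    · rw [Nat.dvd_iff_mod_eq_zero] at e'
      rw [← e]
      omega
  have hm : ∀ r q, l.parts r ≤ q → (∀ c, l.parts r < c → c ≤ q → colRes h c = i) →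
      (∀ s, s + 1 = r → q < l.parts s ∨ (q = l.parts s ∧ h ∣ q)) → q ≤ P.parts r := by
    intro r q h1 h2 h3
    rcases Nat.eq_or_lt_of_le h1 with e | e
    · rw [← e]; exact hP.2.1 r
    obtain ⟨v, hv⟩ := s_mk (fun s => if s = r then q else l.parts s) (by
      intro s
      have := l.antitone s
      by_cases e1 : s = r
      · subst e1; simp; omega
      · by_cases e2 : s + 1 = r
        · have := h3 s e2
          subst e2; simp; omega
        · simp [e1, e2]; exact this) (by
      obtain ⟨R, hR⟩ := s_bound l
      refine ⟨max R (r+1), fun s hs => ?_⟩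
      have e1 : ¬ s = r := by omega
      simp [e1]; exact hR s (by omega))
    have := hmax v ⟨?_, ?_, ?_⟩ r
    · rw [hv] at this; simpa using this
    · rw [s_hs] at hl ⊢
      intro s
      have := l.antitone s
      rw [hv, hv]
      by_cases e1 : s = r
      · subst e1
        simp
        omega
      · by_cases e2 : s + 1 = r
        · have := h3 s e2
          subst e2; simp
          intro e3
          rw [← e3]
          omega
        · simp [e1, e2]; exact hl s
    · intro s
      rw [hv]
      by_cases e1 : s = r
      · subst e1; simp; omega
      · simp [e1]
    · intro s c
      rw [hv]
      by_cases e1 : s = r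
      · subst e1
        simpa using h2 c
      · simp [e1]; omega
  induction R with
  | zero =>
    simp
    exact s_row0 n h i _ _ hn hh hi (hP.2.1 0) (hP.2.2 0) (hR 0)
      (fun q a b => hm 0 q a b (by intro s hs; omega))
  | succ R ih =>
    rw [Finset.sum_range_succ, ih, Finset.sum_range_succ _ (R+1), Finset.sum_range_succ _ (R+1)]
    have := s_row1 n h i (l.parts (R+1)) (P.parts (R+1)) (l.parts R) (P.parts R) hn hh hi
      (hP.2.1 _) (hP.2.2 _) (hR _) (l.antitone R) (s_hs.1 hl R) (P.antitone R) (s_hs.1 hP.1 R)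
      (hP.2.2 R) (by
        intro hC
        exact s_norem n h i hn hh l hl hr R hC)
      (fun q a b c => hm (R+1) q a b (by
        intro s hs
        have : s = R := by omega
        rw [this]; exact c))
    linarith

theorem s_sg_zero (n h i : ℕ) (hn : 1 ≤ n) (hh : h = 2*n+1) (hi : i ≤ n) : sg h i 0 = 0 := by
  unfold sg
  rw [Nat.zero_mod]
  split_ifs <;> first | omega | (simp only [false_or] at *; omega)

theorem s_sum_parts (l : BPartition) (f : ℕ → ℤ) (hf : f 0 = 0) (R : ℕ)
    (hR : ∀ r, R ≤ r → l.parts r = 0) :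
    ∑ r ∈ Finset.range R, f (l.parts r) = ((partsM l).map f).sum := by
  unfold partsM
  rw [Multiset.map_map]
  show _ = ∑ r ∈ l.parts.support, f (l.parts r)
  symm
  apply Finset.sum_subset
  · intro r hr
    rw [Finset.mem_range]
    by_contra hc
    exact (Finsupp.mem_support_iff.1 hr) (hR r (by omega))
  · intro r _ hr
    rw [Finsupp.notMem_support_iff.1 hr, hf]

theorem s_pos {l : BPartition} {x : ℕ} (hx : x ∈ partsM l) : 0 < x := by
  unfold partsM at hx
  rw [Multiset.mem_map] at hx
  obtain ⟨r, hr, rfl⟩ := hx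
  have := Finsupp.mem_support_iff.1 (show r ∈ l.parts.support from hr)
  omega

theorem s_sg_neg (n h i a b : ℕ) (hn : 1 ≤ n) (hh : h = 2*n+1) (hi : i ≤ n) (ha : 0 < a)
    (hb : 0 < b) (hab : a + b = h) : sg h i a + sg h i b = 0 := by
  unfold sg
  rw [Nat.mod_eq_of_lt (show a < h by omega), Nat.mod_eq_of_lt (show b < h by omega)]
  split_ifs <;> omega

theorem s_step (n h i : ℕ) (hn : 1 ≤ n) (hh : h = 2*n+1) (hi : i ≤ n) {l m : BPartition}
    (H : barStep h l m) : ((partsM l).map (sg h i)).sum = ((partsM m).map (sg h i)).sum ∧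
      ((partsM l).map (fun x : ℕ => (x : ℤ))).sum =
        ((partsM m).map (fun x : ℕ => (x : ℤ))).sum + h := by
  obtain ⟨v, -, ⟨rfl, hv, e⟩ | ⟨hlt, hv, e⟩ | ⟨a, b, hab, ha, hb, -, e⟩⟩ := H
  · rw [e, ← Multiset.cons_erase hv]
    have : sg v i v = 0 := by
      rw [← s_sg_zero n v i hn hh hi]; unfold sg; simp
    simp [this]; ring
  · rw [e, ← Multiset.cons_erase hv]
    have : sg h i v = sg h i (v - h) := by
      have k : (v - h) % h = v % h := (Nat.mod_eq_sub_mod (by omega)).symm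
      unfold sg; rw [k]
    simp [this]
    rw [Nat.cast_sub (by omega)]; ring
  · have p1 := s_pos ha
    have p2 := s_pos (Multiset.mem_of_mem_erase hb)
    have := s_sg_neg n h i a b hn hh hi p1 p2 hab
    rw [e, ← Multiset.cons_erase ha, ← Multiset.cons_erase hb]
    simp
    refine ⟨by linarith, ?_⟩
    rw [← hab]; push_cast; ring

theorem s_chain (n h i : ℕ) (hn : 1 ≤ n) (hh : h = 2*n+1) (hi : i ≤ n) (w : ℕ) (l m : BPartition)
    (H : barChain h w l m) : ((partsM l).map (sg h i)).sum = ((partsM m).map (sg h i)).sum ∧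
      ((partsM l).map (fun x : ℕ => (x : ℤ))).sum =
        ((partsM m).map (fun x : ℕ => (x : ℤ))).sum + w * h := by
  induction w generalizing l with
  | zero =>
    have : l = m := H
    subst this
    simp
  | succ w ih =>
    obtain ⟨v, h1, h2⟩ := H
    have a := s_step n h i hn hh hi h1
    have b := ih v h2
    refine ⟨a.1.trans b.1, ?_⟩
    rw [a.2, b.2]; push_cast; ring

theorem s_count' (n h i : ℕ) (hn : 1 ≤ n) (hh : h = 2*n+1) (hi : i ≤ n) (l P : BPartition)
    (hl : IsHStrict h l) (hr : ∀ x, ¬ Removable h i l x) (hP : SExt h i l P)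
    (hmax : ∀ v, SExt h i l v → ∀ r, v.parts r ≤ P.parts r) :
    ((partsM P).map (fun x : ℕ => (x : ℤ))).sum = ((partsM l).map (fun x : ℕ => (x : ℤ))).sum +
      ((partsM l).map (sg h i)).sum + se h i 0 := by
  obtain ⟨R1, hR1⟩ := s_bound l
  obtain ⟨R2, hR2⟩ := s_bound P
  have := s_count n h i hn hh hi l P hl hr hP hmax (max R1 R2)
  rw [s_sum_parts l (sg h i) (s_sg_zero n h i hn hh hi) _ (fun r hr => hR1 r (by omega)),
    s_sum_parts l (fun x : ℕ => (x : ℤ)) (by simp) _ (fun r hr => hR1 r (by omega)),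
    s_sum_parts P (fun x : ℕ => (x : ℤ)) (by simp) _ (fun r hr => hR2 r (by omega)),
    hR1 _ (le_max_left _ _)] at this
  exact this

theorem s_eq_of_le (l P : BPartition) (h : ∀ r, l.parts r ≤ P.parts r)
    (hs : ((partsM P).map (fun x : ℕ => (x : ℤ))).sum =
      ((partsM l).map (fun x : ℕ => (x : ℤ))).sum) : l = P := by
  obtain ⟨R1, hR1⟩ := s_bound l
  obtain ⟨R2, hR2⟩ := s_bound P
  rw [← s_sum_parts l (fun x : ℕ => (x : ℤ)) (by simp) (max R1 R2) (fun r hr => hR1 r (by omega)),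
    ← s_sum_parts P (fun x : ℕ => (x : ℤ)) (by simp) (max R1 R2) (fun r hr => hR2 r (by omega))] at hs
  have := (Finset.sum_eq_sum_iff_of_le (s := Finset.range (max R1 R2))
    (f := fun r => (l.parts r : ℤ)) (g := fun r => (P.parts r : ℤ))
    (fun r _ => by exact_mod_cast h r)).1 hs.symm
  apply s_ext
  intro r
  by_cases hr : r < max R1 R2
  · exact_mod_cast this r (Finset.mem_range.2 hr)
  · rw [hR1 r (by omega), hR2 r (by omega)]

end BPartition

namespace BPartition

/-- main argument given maximality -/
theorem s_main (n h i : ℕ) (hn : 1 ≤ n) (hh : h = 2*n+1) (hi : i ≤ n)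
    (lam mu hlam hmu : BPartition) (h1 : IsHStrict h lam) (h2 : IsHStrict h mu)
    (h4 : IsHStrict h hmu)
    (hL2 : Link h i mu hmu) (hr : ∀ x, ¬ Removable h i lam x) (hE : SExt h i lam hlam)
    (hmax : ∀ v, SExt h i lam v → ∀ r, v.parts r ≤ hlam.parts r) :
    (lexLT mu lam → lexLT hmu hlam) ∧ (colexLT lam mu → colexLT hlam hmu) := by
  have hR := s_norem n h i hn hh lam h1 hr
  rw [s_hs] at h1 h2 h4
  constructor
  · rintro ⟨r, hlt, heq⟩
    have hcol : ∀ s, s ≤ r → ∀ c, lam.parts s < c → c ≤ hmu.parts s → colRes h c = i := by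
      intro s hs c a b
      refine s_link_col hL2 s c ?_ b
      rcases Nat.eq_or_lt_of_le hs with e | e
      · subst e; omega
      · rw [heq s e]; exact a
    have hle : ∀ s, s ≤ r → hmu.parts s ≤ hlam.parts s := by
      obtain ⟨v, hv⟩ := s_mk (fun s => if s ≤ r then max (hmu.parts s) (lam.parts s) else lam.parts s) (by
        intro s
        have a := lam.antitone s
        have b := hmu.antitone s
        try simp only
        split_ifs <;> omega) (by
        obtain ⟨R, hR⟩ := s_bound lam
        refine ⟨max R (r+1), fun s hs => ?_⟩
        have := hR s (by omega)
        try simp only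
        split_ifs <;> omega)
      have := hmax v ⟨?_, ?_, ?_⟩
      · intro s hs
        have := this s
        rw [hv, if_pos hs] at this
        omega
      · rw [s_hs]
        intro s
        have a := lam.antitone s
        have b := hmu.antitone s
        rw [hv, hv]
        intro e
        by_cases e1 : s ≤ r
        · rw [if_pos e1] at e ⊢
          rcases Nat.le_total (hmu.parts s) (lam.parts s) with e2 | e2
          · rw [max_eq_right e2] at e ⊢
            by_cases e3 : lam.parts (s+1) = lam.parts s
            · exact h1 s e3
            · have : hmu.parts (s+1) = hmu.parts s ∧ hmu.parts s = lam.parts s := by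
                split_ifs at e <;> omega
              rw [← this.2]; exact h4 s this.1
          · rw [max_eq_left e2] at e ⊢
            by_cases e3 : hmu.parts (s+1) = hmu.parts s
            · exact h4 s e3
            · have : lam.parts (s+1) = lam.parts s ∧ hmu.parts s = lam.parts s := by
                split_ifs at e <;> omega
              rw [this.2]; exact h1 s this.1
        · rw [if_neg e1, if_neg (by omega)] at e
          rw [if_neg e1]
          exact h1 s e
      · intro s
        rw [hv]
        split_ifs <;> omega
      · intro s c
        rw [hv]
        split_ifs with e
        · intro a b
          exact hcol s e c a (by omega)
        · omega
    by_cases hall : ∀ s, s ≤ r → hmu.parts s = hlam.parts s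
    · have e0 := hall r le_rfl
      have l0 := hE.2.1 r
      have l1 := hE.2.1 (r+1)
      have hcr : ∀ c, mu.parts r < c → c ≤ lam.parts r → colRes h c = i := fun c a b =>
        s_link_col hL2 r c a (by omega)
      have hC := hcr _ hlt le_rfl
      have hRr := hR r hC
      have key : hmu.parts (r+1) < hlam.parts (r+1) := by
        have m1 := s_modsucc h (mu.parts r) (by omega)
        have a1 := mu.antitone r
        have a2 := h2 r
        have mr : mu.parts r + 1 = lam.parts r := by
          by_contra hne
          obtain ⟨c, hc⟩ : ∃ c, lam.parts r = c + 1 := ⟨lam.parts r - 1, by omega⟩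
          have cc := s_cons n h i c hn hh hi (hcr c (by omega) (by omega)) (by rw [← hc]; exact hC)
          have mm := s_modsucc h c (by omega)
          rcases hRr with ⟨_, d⟩ | ⟨d, d'⟩
          · rw [Nat.dvd_iff_mod_eq_zero, hc] at d
            omega
          · rw [Nat.dvd_iff_mod_eq_zero] at d'
            have : lam.parts (r+1) = c := by omega
            rw [this] at d'
            omega
        have nd : mu.parts r % h ≠ 0 := by
          rcases hRr with ⟨_, d⟩ | ⟨d, d'⟩
          · rw [Nat.dvd_iff_mod_eq_zero, ← mr] at d
            omega
          · rw [Nat.dvd_iff_mod_eq_zero] at d'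
            have : lam.parts (r+1) = mu.parts r := by omega
            rw [this] at d'
            omega
        have a3 : mu.parts (r+1) < mu.parts r := by
          rcases Nat.eq_or_lt_of_le a1 with e | e
          · rw [Nat.dvd_iff_mod_eq_zero] at a2
            exact absurd (a2 e) nd
          · exact e
        have a4 : hmu.parts (r+1) < mu.parts r := by
          by_contra hc
          have := s_link_col hL2 (r+1) (mu.parts r) a3 (by omega)
          have := s_cons n h i _ hn hh hi this (by rw [mr]; exact hC)
          omega
        omega
      refine ⟨r+1, key, fun s hs => hall s (by omega)⟩
    · classical
      push Not at hall
      have hf := Nat.find_spec hall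
      refine ⟨Nat.find hall, ?_, ?_⟩
      · have := hle _ hf.1
        omega
      · intro s hs
        have := Nat.find_min hall hs
        by_contra hc
        exact this ⟨by omega, hc⟩
  · rintro ⟨r, hlt, heq⟩
    have hnC : colRes h (lam.parts r) ≠ i := by
      intro hC
      have e := heq (r+1) (by omega)
      have a1 := mu.antitone r
      have a2 := h2 r
      rcases hR r hC with ⟨d, _⟩ | ⟨d, d'⟩
      · omega
      · rw [e] at d'
        have := a2 (by omega)
        rw [show mu.parts r = mu.parts (r+1) by omega] at this
        exact d' this
    have hrr : hmu.parts r < lam.parts r := by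
      by_contra hc
      exact hnC (s_link_col hL2 r _ hlt (by omega))
    have l0 := hE.2.1 r
    have hle : ∀ s, r < s → hmu.parts s ≤ hlam.parts s := by
      have h3 := s_hs.1 hE.1
      obtain ⟨v, hv⟩ := s_mk (fun s => if r < s then max (hmu.parts s) (hlam.parts s) else hlam.parts s) (by
        intro s
        have a := hlam.antitone s
        have b := hmu.antitone s
        try simp only
        by_cases e : s = r
        · subst e
          split_ifs <;> omega
        · split_ifs <;> omega) (by
        obtain ⟨R, hR⟩ := s_bound hlam
        obtain ⟨R', hR'⟩ := s_bound hmu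
        refine ⟨max R R', fun s hs => ?_⟩
        have := hR s (by omega)
        have := hR' s (by omega)
        try simp only
        split_ifs <;> omega)
      have := hmax v ⟨?_, ?_, ?_⟩
      · intro s hs
        have := this s
        rw [hv, if_pos hs] at this
        omega
      · rw [s_hs]
        intro s
        have a := hlam.antitone s
        have b := hmu.antitone s
        rw [hv, hv]
        intro e
        by_cases e1 : r < s
        · rw [if_pos e1] at e ⊢
          rw [if_pos (by omega)] at e
          rcases Nat.le_total (hmu.parts s) (hlam.parts s) with e2 | e2
          · rw [max_eq_right e2] at e ⊢
            by_cases e3 : hlam.parts (s+1) = hlam.parts s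
            · exact h3 s e3
            · have : hmu.parts (s+1) = hmu.parts s ∧ hmu.parts s = hlam.parts s := by
                omega
              rw [← this.2]; exact h4 s this.1
          · rw [max_eq_left e2] at e ⊢
            by_cases e3 : hmu.parts (s+1) = hmu.parts s
            · exact h4 s e3
            · have : hlam.parts (s+1) = hlam.parts s ∧ hmu.parts s = hlam.parts s := by
                omega
              rw [this.2]; exact h3 s this.1
        · rw [if_neg e1] at e ⊢
          apply h3 s
          by_cases e2 : s = r
          · subst e2
            rw [if_pos (by omega)] at e
            omega
          · rw [if_neg (by omega)] at e
            exact e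
      · intro s
        have := hE.2.1 s
        rw [hv]
        split_ifs <;> omega
      · intro s c
        rw [hv]
        split_ifs with e
        · intro a b
          by_cases e1 : c ≤ hlam.parts s
          · exact hE.2.2 s c a e1
          · refine s_link_col hL2 s c ?_ (by omega)
            rw [← heq s e]; exact a
        · exact hE.2.2 s c
    classical
    obtain ⟨R, hR⟩ := s_bound hlam
    obtain ⟨R', hR'⟩ := s_bound hmu
    let Q : ℕ → Prop := fun s => hmu.parts s < hlam.parts s
    have hQr : Q r := by show _ < _; omega
    have hrb : r ≤ max R R' := by
      by_contra hc
      have := hR r (by omega)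
      omega
    refine ⟨Nat.findGreatest Q (max R R'), Nat.findGreatest_spec (P := Q) hrb hQr, ?_⟩
    intro s hs
    have hge := Nat.le_findGreatest hrb hQr
    by_cases hsb : s ≤ max R R'
    · have := Nat.findGreatest_is_greatest hs hsb
      have h5 := hle s (by omega)
      have h6 : ¬ hmu.parts s < hlam.parts s := this
      omega
    · rw [hR s (by omega), hR' s (by omega)]

end BPartition

namespace BPartition

theorem s_mkM (h : ℕ) (M : Multiset ℕ) (hpos : ∀ x ∈ M, 0 < x)
    (hc : ∀ x, ¬ h ∣ x → M.count x ≤ 1) : ∃ v : BPartition, IsHStrict h v ∧ partsM v = M := by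
  classical
  let l := M.sort (· ≥ ·)
  have hlM : (l : Multiset ℕ) = M := Multiset.sort_eq M _
  have hsort : l.Pairwise (· ≥ ·) := Multiset.pairwise_sort M _
  have hin : ∀ r (hr : r < l.length), l.getD r 0 = l[r] := fun r hr => by
    simp [List.getD_eq_getElem?_getD, List.getElem?_eq_getElem hr]
  have hout : ∀ r, l.length ≤ r → l.getD r 0 = 0 := fun r hr => by
    simp [List.getD_eq_getElem?_getD, List.getElem?_eq_none hr]
  have hp : ∀ r (hr : r < l.length), 0 < l[r] := fun r hr => hpos _ (by
    rw [← hlM]; exact List.getElem_mem hr)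
  obtain ⟨v, hv⟩ := s_mk (fun r => l.getD r 0) (by
    intro r
    show l.getD (r+1) 0 ≤ l.getD r 0
    by_cases h1 : r + 1 < l.length
    · rw [hin _ h1, hin r (by omega)]
      exact List.pairwise_iff_getElem.1 hsort r (r+1) (by omega) h1 (by omega)
    · rw [hout _ (by omega)]; omega) ⟨l.length, hout⟩
  refine ⟨v, ?_, ?_⟩
  · rw [s_hs]
    intro r
    rw [hv, hv]
    intro e
    by_cases h1 : r + 1 < l.length
    · rw [hin _ h1, hin r (by omega)] at e
      rw [hin r (by omega)]
      by_contra hd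
      have hc2 : ∀ x, ¬ h ∣ x → l.count x ≤ 1 := fun x hx => by
        rw [← Multiset.coe_count, hlM]; exact hc x hx
      have := hc2 _ hd
      have h2 : List.Duplicate l[r] l := by
        rw [List.duplicate_iff_exists_distinct_get]
        exact ⟨⟨r, by omega⟩, ⟨r+1, h1⟩, by simp, by simp, by simp [e]⟩
      rw [List.duplicate_iff_two_le_count] at h2
      omega
    · rw [hout (r+1) (by omega)] at e
      rw [← e]; exact dvd_zero h
  · have hsup : v.parts.support = Finset.range l.length := by
      ext r
      rw [Finsupp.mem_support_iff, Finset.mem_range, hv]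
      by_cases h1 : r < l.length
      · rw [hin r h1]
        have := hp r h1
        simp [h1]; omega
      · rw [hout r (by omega)]; simp [h1]
    unfold partsM
    rw [hsup, ← hlM]
    show Multiset.map _ (Multiset.range _) = _
    rw [← Multiset.coe_range, Multiset.map_coe, Multiset.coe_eq_coe]
    apply List.Perm.of_eq
    apply List.ext_getElem
    · simp
    · intro r h1 h2
      simp only [List.getElem_map, List.getElem_range]
      rw [hv, hin r h2]

theorem s_mem {l : BPartition} {x : ℕ} : x ∈ partsM l ↔ 0 < x ∧ ∃ r, l.parts r = x := by
  constructor
  · intro hx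
    refine ⟨s_pos hx, ?_⟩
    unfold partsM at hx
    rw [Multiset.mem_map] at hx
    obtain ⟨r, hr, e⟩ := hx
    exact ⟨r, e⟩
  · rintro ⟨hx, r, rfl⟩
    unfold partsM
    rw [Multiset.mem_map]
    exact ⟨r, (show r ∈ l.parts.support from Finsupp.mem_support_iff.2 (by omega)), rfl⟩

theorem s_cnt {h : ℕ} {l : BPartition} (hl : IsHStrict h l) (x : ℕ) (hx : ¬ h ∣ x) :
    (partsM l).count x ≤ 1 := by
  classical
  rw [s_hs] at hl
  have key : ∀ r s, r < s → l.parts r = x → l.parts s = x → False := by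
    intro r s hrs h1 h2
    have a := s_anti l (show r + 1 ≤ s by omega)
    have b := l.antitone r
    have := hl r (by omega)
    rw [h1] at this
    exact hx this
  unfold partsM
  rw [Multiset.count_map]
  show (Finset.filter (fun r => x = l.parts r) l.parts.support).card ≤ 1
  rw [Finset.card_le_one]
  intro r hr s hs
  have h1 := (Finset.mem_filter.1 hr).2
  have h2 := (Finset.mem_filter.1 hs).2
  rcases Nat.lt_trichotomy r s with e | e | e
  · exact (key r s e h1.symm h2.symm).elim
  · exact e
  · exact (key s r e h2.symm h1.symm).elim

theorem s_K0 {h : ℕ} (hh : 0 < h) {l : BPartition} (hl : IsBarCore h l) {p : ℕ} (hp : p ∈ partsM l) :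
    ¬ h ∣ p := by
  intro hd
  have pp := s_pos hp
  rcases Nat.eq_or_lt_of_le (Nat.le_of_dvd pp hd) with e | e
  · obtain ⟨v, hv, e'⟩ := s_mkM h ((partsM l).erase p)
      (fun x hx => s_pos (Multiset.mem_of_mem_erase hx))
      (fun x hx => (Multiset.count_le_of_le x (Multiset.erase_le _ _)).trans (s_cnt hl.1 x hx))
    exact hl.2 v ⟨p, hv, Or.inl ⟨e.symm, hp, e'⟩⟩
  · obtain ⟨v, hv, e'⟩ := s_mkM h ((p - h) ::ₘ (partsM l).erase p)
      (fun x hx => by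
        rcases Multiset.mem_cons.1 hx with rfl | hx
        · omega
        · exact s_pos (Multiset.mem_of_mem_erase hx))
      (fun x hx => by
        rw [Multiset.count_cons_of_ne (by
          rintro rfl
          exact hx (Nat.dvd_sub hd (dvd_refl h)))]
        exact (Multiset.count_le_of_le x (Multiset.erase_le _ _)).trans (s_cnt hl.1 x hx))
    exact hl.2 v ⟨p, hv, Or.inr (Or.inl ⟨e, hp, e'⟩)⟩

theorem s_K1 {h : ℕ} {l : BPartition} (hl : IsBarCore h l) {p : ℕ} (hp : p ∈ partsM l)
    (hlt : h < p) : p - h ∈ partsM l := by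
  by_contra hn
  obtain ⟨v, hv, e'⟩ := s_mkM h ((p - h) ::ₘ (partsM l).erase p)
      (fun x hx => by
        rcases Multiset.mem_cons.1 hx with rfl | hx
        · omega
        · exact s_pos (Multiset.mem_of_mem_erase hx))
      (fun x hx => by
        by_cases e : x = p - h
        · subst e
          rw [Multiset.count_cons_self, Multiset.count_eq_zero_of_notMem
            (fun hx => hn (Multiset.mem_of_mem_erase hx))]
        · rw [Multiset.count_cons_of_ne e]
          exact (Multiset.count_le_of_le x (Multiset.erase_le _ _)).trans (s_cnt hl.1 x hx))
  exact hl.2 v ⟨p, hv, Or.inr (Or.inl ⟨hlt, hp, e'⟩)⟩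

theorem s_K1' {h : ℕ} {l : BPartition} (hl : IsBarCore h l) (t p : ℕ) (hp : 0 < p)
    (ht : p + t * h ∈ partsM l) : p ∈ partsM l := by
  induction t with
  | zero => simpa using ht
  | succ t ih =>
    rcases Nat.eq_zero_or_pos h with e | e
    · subst e; simpa using ht
    apply ih
    have := s_K1 hl ht (by rw [Nat.succ_mul]; omega)
    rw [Nat.succ_mul] at this
    rwa [show p + (t * h + h) - h = p + t * h by omega] at this

theorem s_K1'' {h : ℕ} {l : BPartition} (hl : IsBarCore h l) (q p : ℕ) (hp : 0 < p) (hpq : p ≤ q)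
    (he : p % h = q % h) (hq : q ∈ partsM l) : p ∈ partsM l := by
  have : h ∣ q - p := (Nat.modEq_iff_dvd' hpq).1 he
  obtain ⟨t, ht⟩ := this
  apply s_K1' hl t p hp
  rw [Nat.mul_comm, ← ht]
  rwa [show p + (q - p) = q by omega]

theorem s_K2 {n h : ℕ} (hh : h = 2*n+1) {l : BPartition} (hl : IsBarCore h l) {a b : ℕ}
    (ha : a ∈ partsM l) (hb : b ∈ partsM l) (hab : a + b = h) : False := by
  have hb' : b ∈ (partsM l).erase a := (Multiset.mem_erase_of_ne (by omega)).2 hb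
  obtain ⟨v, hv, e'⟩ := s_mkM h (((partsM l).erase a).erase b)
      (fun x hx => s_pos (Multiset.mem_of_mem_erase (Multiset.mem_of_mem_erase hx)))
      (fun x hx => (Multiset.count_le_of_le x
        ((Multiset.erase_le _ _).trans (Multiset.erase_le _ _))).trans (s_cnt hl.1 x hx))
  exact hl.2 v ⟨max a b, hv, Or.inr (Or.inr ⟨a, b, hab, ha, hb', rfl, e'⟩)⟩

theorem s_K2' {n h : ℕ} (hh : h = 2*n+1) {l : BPartition} (hl : IsBarCore h l) {a b : ℕ}
    (ha : a ∈ partsM l) (hb : b ∈ partsM l) (hab : a % h + b % h = h) : False := by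
  have m1 := Nat.mod_lt a (show 0 < h by omega)
  have m2 := Nat.mod_lt b (show 0 < h by omega)
  refine s_K2 hh hl (s_K1'' hl a (a % h) (by omega) (Nat.mod_le _ _) (Nat.mod_mod _ _) ha)
    (s_K1'' hl b (b % h) (by omega) (Nat.mod_le _ _) (Nat.mod_mod _ _) hb) hab

theorem s_core_norem (n h i : ℕ) (hn : 1 ≤ n) (hh : h = 2*n+1) (hi : i ≤ n) (l : BPartition)
    (hl : IsBarCore h l) (x : ℕ × ℕ) (hx : Addable h i l x) (y : ℕ × ℕ) : ¬ Removable h i l y := by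
  classical
  intro hy
  have h0 : 0 < h := by omega
  -- addable data
  obtain ⟨q, hq, hqC, hqn⟩ : ∃ q, (q = 0 ∨ q ∈ partsM l) ∧ colRes h (q+1) = i ∧ q+1 ∉ partsM l := by
    obtain ⟨hx1, v, hv, hx2⟩ := s_addable.1 hx
    have hex : ∃ r, l.parts r < v.parts r := ⟨x.1, by
      by_contra hc
      exact hx1 ⟨hx2.1, hx2.2.trans (by omega)⟩⟩
    have hf := Nat.find_spec hex
    have hmin : ∀ s, s < Nat.find hex → ¬ l.parts s < v.parts s := fun s hs => Nat.find_min hex hs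
    generalize Nat.find hex = r at hf hmin
    refine ⟨l.parts r, ?_, hv.2.2 r _ (by omega) (by omega), ?_⟩
    · rcases Nat.eq_zero_or_pos (l.parts r) with e | e
      · exact Or.inl e
      · exact Or.inr (s_mem.2 ⟨e, r, rfl⟩)
    · intro hm
      have hnd := s_K0 h0 hl hm
      obtain ⟨-, s, hs⟩ := s_mem.1 hm
      have hsr : s < r := by
        by_contra hc
        have := s_anti l (show r ≤ s by omega)
        omega
      have e1 := hmin s hsr
      have e2 := hv.2.1 s
      have e3 := s_anti v (show s + 1 ≤ r by omega)
      have e4 := v.antitone s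
      have := s_hs.1 hv.1 s (by omega)
      rw [show v.parts s = l.parts r + 1 by omega] at this
      exact hnd this
  obtain ⟨p, hp, hpC, hpn⟩ : ∃ p, p ∈ partsM l ∧ colRes h p = i ∧ p - 1 ∉ partsM l := by
    obtain ⟨hy1, m, hm1, hm2, hm3, hy2⟩ := s_removable.1 hy
    obtain ⟨R, hR⟩ := s_bound l
    let Q : ℕ → Prop := fun r => m.parts r < l.parts r
    have hQ : Q y.1 := by
      show _ < _
      by_contra hc
      exact hy2 ⟨hy1.1, hy1.2.trans (by omega)⟩
    have hb : y.1 ≤ R := by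
      by_contra hc
      have := hR y.1 (by omega)
      have h5 : m.parts y.1 < l.parts y.1 := hQ
      omega
    have hf : Q (Nat.findGreatest Q R) := Nat.findGreatest_spec (P := Q) hb hQ
    have hmx : ∀ s, Nat.findGreatest Q R < s → ¬ m.parts s < l.parts s := by
      intro s hs
      by_cases hsb : s ≤ R
      · have h6 : ¬ Q s := Nat.findGreatest_is_greatest (P := Q) hs hsb
        exact h6
      · rw [hR s (by omega)]; omega
    generalize Nat.findGreatest Q R = r at hf hmx
    have hf : m.parts r < l.parts r := hf
    refine ⟨l.parts r, s_mem.2 ⟨by omega, r, rfl⟩, hm3 r _ hf le_rfl, ?_⟩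
    intro hm
    have hnd := s_K0 h0 hl hm
    obtain ⟨hpos, s, hs⟩ := s_mem.1 hm
    have hsr : r < s := by
      by_contra hc
      have := s_anti l (show s ≤ r by omega)
      omega
    have e1 := hmx s hsr
    have e2 := hm2 s
    have e3 := s_anti m (show r + 1 ≤ s by omega)
    have e4 := m.antitone r
    have := s_hs.1 hm1 r (by omega)
    rw [show m.parts r = l.parts r - 1 by omega] at this
    exact hnd this
  have pp := s_pos hp
  have hpd := s_K0 h0 hl hp
  rw [Nat.dvd_iff_mod_eq_zero] at hpd
  rw [s_col n h i _ hn hh hi] at hqC hpC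
  have m1 := s_modsucc h q h0
  have m0 := Nat.mod_lt p h0
  rcases hq with rfl | hq
  · have e : (0+1) % h = 1 := Nat.mod_eq_of_lt (by omega)
    rw [e] at hqC
    apply hqn
    refine s_K1'' hl p 1 (by omega) (by omega) ?_ hp
    rw [Nat.mod_eq_of_lt (show 1 < h by omega)]
    omega
  · have hqd := s_K0 h0 hl hq
    rw [Nat.dvd_iff_mod_eq_zero] at hqd
    by_cases hsum : p % h + q % h = h
    · exact s_K2' hh hl hp hq hsum
    · have he : p % h = (q + 1) % h := by omega
      rcases Nat.lt_or_ge q p with hlt | hge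
      · exact hqn (s_K1'' hl p (q+1) (by omega) (by omega) he.symm hp)
      · have m2 := s_modsucc h (p-1) h0
        rw [show p - 1 + 1 = p by omega] at m2
        have : 0 < p - 1 := by
          by_contra hc
          have : p = 1 := by omega
          rw [this, Nat.mod_eq_of_lt (show 1 < h by omega)] at he
          omega
        exact hpn (s_K1'' hl q (p-1) this (by omega) (by omega) hq)

theorem s_diag_fin (l : BPartition) : (diagram l).Finite := by
  obtain ⟨R, hR⟩ := s_bound l
  apply ((Set.finite_Iio R).prod (Set.finite_Iic (l.parts 0))).subset
  intro x hx
  have h1 : 1 ≤ x.2 := hx.1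
  have h2 : x.2 ≤ l.parts x.1 := hx.2
  refine ⟨?_, h2.trans (s_anti l (Nat.zero_le _))⟩
  show x.1 < R
  by_contra hc
  have := hR x.1 (by omega)
  omega

theorem s_psi (h i : ℕ) (l P : BPartition) (hr : ∀ x, ¬ Removable h i l x) (hP : SExt h i l P)
    (hmax : ∀ v, SExt h i l v → ∀ r, v.parts r ≤ P.parts r) : psi h i l = P := by
  have hadd : ∀ x, Addable h i l x ↔ x ∉ diagram l ∧ x ∈ diagram P := by
    intro x
    rw [s_addable]
    constructor
    · rintro ⟨h1, v, h2, h3⟩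
      exact ⟨h1, s_diag_sub.2 (hmax v h2) h3⟩
    · rintro ⟨h1, h2⟩
      exact ⟨h1, P, hP, h2⟩
  have hfin : {x | Addable h i l x}.Finite := (s_diag_fin P).subset (fun x hx => ((hadd x).1 hx).2)
  have hcon : ∀ x, Conormal h i l x ↔ Addable h i l x := by
    intro x
    refine ⟨fun H => H.1, fun H => ⟨H, fun z hz => ?_⟩⟩
    have e1 : {y | Removable h i l y ∧ posLE x y ∧ posLE y z} = ∅ := by
      ext y; simp [hr y]
    rw [e1, Set.ncard_empty]
    rw [Set.ncard_pos (hfin.subset (fun y hy => hy.1))]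
    exact ⟨x, H, Or.inr ⟨rfl, le_rfl⟩, hz⟩
  have hnor : {x | Normal h i l x} = ∅ := by
    ext x
    simp only [Set.mem_setOf_eq, Set.mem_empty_iff_false, iff_false]
    exact fun H => hr x H.1
  have hset : psiSet h i l = diagram P := by
    unfold psiSet
    rw [hnor, Set.ncard_empty, if_pos (Nat.zero_le _), Nat.sub_zero]
    simp only [hcon]
    ext x
    constructor
    · rintro (hx | hx)
      · exact s_diag_sub.2 hP.2.1 hx
      · exact ((hadd x).1 hx.1).2
    · intro hx
      by_cases hxl : x ∈ diagram l
      · exact Or.inl hxl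
      · exact Or.inr ⟨(hadd x).2 ⟨hxl, hx⟩, Set.ncard_le_ncard (fun y hy => hy.1) hfin⟩
  have hex : ∃ mu : BPartition, diagram mu = psiSet h i l := ⟨P, hset.symm⟩
  unfold psi
  rw [dif_pos hex]
  exact s_diag_inj (hex.choose_spec.trans hset)

end BPartition

open BPartition in
/-- In a [w:k]-pair (P_{σ,w}, P_{τ,w}) of residue i, with λ ↔ᵢ λ̂, μ ↔ᵢ μ̂ and λ
unexceptional: μ <lex λ implies μ̂ <lex λ̂, and λ <colex μ implies λ̂ <colex μ̂. -/
theorem stmt10 (n h : ℕ) (hn : 1 ≤ n) (hh : h = 2 * n + 1) (i k w : ℕ) (hi : i ≤ n)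
    (hk : 1 ≤ k) (σ : BPartition) (hσ : IsBarCore h σ)
    (hcnt : Set.ncard {x : ℕ × ℕ | Addable h i σ x} = k)
    (τ : BPartition) (hτ : τ = psi h i σ)
    (lam mu hlam hmu : BPartition)
    (h1 : InBlock h σ w lam) (h2 : InBlock h σ w mu)
    (h3 : InBlock h τ w hlam) (h4 : InBlock h τ w hmu)
    (hL1 : Link h i lam hlam) (hL2 : Link h i mu hmu)
    (hunex : ∀ x, ¬ Removable h i lam x) :
    (lexLT mu lam → lexLT hmu hlam) ∧ (colexLT lam mu → colexLT hlam hmu) := by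
  obtain ⟨P, hP, hPmax⟩ := s_plus n h i hn hh hi lam h1.1
  obtain ⟨T, hT, hTmax⟩ := s_plus n h i hn hh hi σ hσ.1
  have hne : {x : ℕ × ℕ | Addable h i σ x}.Nonempty := Set.nonempty_of_ncard_ne_zero (by omega)
  obtain ⟨x, hx⟩ := hne
  have hσr := s_core_norem n h i hn hh hi σ hσ x hx
  have hτT : τ = T := hτ.trans (s_psi h i σ T hσr hT hTmax)
  subst hτT
  have hE : SExt h i lam hlam :=
    ⟨h3.1, s_link_le h i lam hlam h1.1 h3.1 hunex hL1, fun r c => s_link_col hL1 r c⟩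
  have heq : hlam = P := by
    apply s_eq_of_le _ _ (hPmax hlam hE)
    have a1 := s_count' n h i hn hh hi lam P h1.1 hunex hP hPmax
    have a2 := s_count' n h i hn hh hi σ τ hσ.1 hσr hT hTmax
    have b1 := s_chain n h i hn hh hi w lam σ h1.2.2
    have b2 := s_chain n h i hn hh hi w hlam τ h3.2.2
    rw [a1, b1.1, b1.2, b2.2, a2]
    ring
  subst heq
  exact s_main n h i hn hh hi lam mu hlam hmu h1.1 h2.1 h4.1 hL2 hunex hE hPmax
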